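/- The centred variables X_{n1} = D₁ − E[D₁] satisfy: (i) limsup_{n→∞} E[e^{θ|X_{n1}|}] < ∞ for some θ > 0; (ii) liminf_{n→∞} Var(X_{n1}) > 0; (iii) liminf_{n→∞} Σ_{j∈ℤ} min{P(X_{n1} = j), P(X_{n1} = j+1)} > 0. -/

import Mathlib

open Filter Real

/-- The unnormalized weight `f(k,γ) = (1/k!) exp(-βk² + γ k log n)`. -/
noncomputable def degWeight (β γ : ℝ) (n : ℕ) (k : ℕ) : ℝ :=
  (1 / (Nat.factorial k : ℝ)) * Real.exp (-β * (k : ℝ) ^ 2 + γ * Real.log n * k)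

/-- The probability mass function of `D₁`:
`P(D₁ = k) = F(γ)⁻¹ (1/k!) exp(-βk² + γ (log n) k)`. -/
noncomputable def degPMF (β γ : ℝ) (n : ℕ) (k : ℕ) : ℝ :=
  degWeight β γ n k / (∑' j : ℕ, degWeight β γ n j)

/-- The mean `E[D₁]`. -/
noncomputable def degMean (β γ : ℝ) (n : ℕ) : ℝ :=
  ∑' k : ℕ, (k : ℝ) * degPMF β γ n k

/-- The variance `Var(D₁)`. -/
noncomputable def degVar (β γ : ℝ) (n : ℕ) : ℝ :=
  ∑' k : ℕ, ((k : ℝ) - degMean β γ n) ^ 2 * degPMF β γ n k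

/-! ### Sequences with geometrically decreasing ratios -/

section LogConcave

variable {w : ℕ → ℝ} {q : ℝ} {m : ℕ}

theorem decay_right (hw : ∀ k, 0 < w k) (hq : 0 < q) (hq1 : q ≤ 1)
    (hlc : ∀ k, w (k + 2) * w k ≤ q * w (k + 1) ^ 2) (hm : w (m + 1) ≤ w m) (j : ℕ) :
    q * w (m + j) ≤ q ^ j * w m := by
  have step : ∀ k, w (k + 1) ≤ w k → w (k + 2) ≤ q * w (k + 1) := by
    intro k hk
    refine le_of_mul_le_mul_right ((hlc k).trans ?_) (hw k)
    nlinarith [mul_le_mul_of_nonneg_left hk (mul_pos hq (hw (k + 1))).le]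
  have anti : ∀ j, w (m + j + 1) ≤ w (m + j) := by
    intro j
    induction j with
    | zero => exact hm
    | succ j ih => exact (step _ ih).trans (mul_le_of_le_one_left (hw _).le hq1)
  induction j with
  | zero => simpa using mul_le_of_le_one_left (hw m).le hq1
  | succ j ih =>
    rcases j with _ | j
    · simpa using mul_le_mul_of_nonneg_left hm hq.le
    · have h := step _ (anti j)
      calc q * w (m + (j + 1 + 1)) ≤ q * (q * w (m + (j + 1))) :=
            mul_le_mul_of_nonneg_left h hq.le
        _ ≤ q * (q ^ (j + 1) * w m) := mul_le_mul_of_nonneg_left ih hq.le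
        _ = q ^ (j + 1 + 1) * w m := by ring

theorem decay_left (hw : ∀ k, 0 < w k) (hq : 0 < q) (hq1 : q ≤ 1)
    (hlc : ∀ k, w (k + 2) * w k ≤ q * w (k + 1) ^ 2) (hm : ∀ k < m, w k ≤ w (k + 1))
    (j : ℕ) : ∀ i, i + j = m → q * w i ≤ q ^ j * w m := by
  induction j with
  | zero =>
    rintro i rfl
    simpa using mul_le_of_le_one_left (hw i).le hq1
  | succ j ih =>
    intro i hi
    rcases j with _ | j
    · subst hi
      simpa using mul_le_mul_of_nonneg_left (hm i (by omega)) hq.le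
    · have h1 : w (i + 1) ≤ w (i + 2) := hm (i + 1) (by omega)
      have h : w i ≤ q * w (i + 1) := by
        refine le_of_mul_le_mul_left ((hlc i).trans ?_) (hw (i + 2))
        nlinarith [mul_le_mul_of_nonneg_left h1 (mul_pos hq (hw (i + 1))).le]
      calc q * w i ≤ q * (q * w (i + 1)) := mul_le_mul_of_nonneg_left h hq.le
        _ ≤ q * (q ^ (j + 1) * w m) := mul_le_mul_of_nonneg_left (ih _ (by omega)) hq.le
        _ = q ^ (j + 1 + 1) * w m := by ring

/-- Two-sided geometric decay away from a mode `m`. -/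
theorem decay_of_mode (hw : ∀ k, 0 < w k) (hq : 0 < q) (hq1 : q ≤ 1)
    (hlc : ∀ k, w (k + 2) * w k ≤ q * w (k + 1) ^ 2) (hm : ∀ k < m, w k ≤ w (k + 1))
    (hm' : w (m + 1) ≤ w m) (k : ℕ) :
    w k ≤ q⁻¹ * q ^ ((k : ℤ) - m).natAbs * w m := by
  rw [mul_assoc, ← div_eq_inv_mul, le_div_iff₀' hq]
  rcases le_total m k with h | h
  · obtain ⟨j, rfl⟩ := Nat.exists_eq_add_of_le h
    have : (((m + j : ℕ) : ℤ) - m).natAbs = j := by omega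
    rw [this]
    exact decay_right hw hq hq1 hlc hm' j
  · have : ((k : ℤ) - m).natAbs = m - k := by omega
    rw [this]
    exact decay_left hw hq hq1 hlc hm _ k (by omega)

end LogConcave

theorem summable_pow_natAbs {ρ : ℝ} (h0 : 0 ≤ ρ) (h1 : ρ < 1) :
    Summable fun z : ℤ => ρ ^ z.natAbs :=
  .of_nat_of_neg (by simpa using summable_geometric_of_lt_one h0 h1)
    (by simpa using summable_geometric_of_lt_one h0 h1)

theorem injective_natCast_sub (m : ℕ) : Function.Injective fun k : ℕ => (k : ℤ) - m :=
  fun a b h => by simpa using h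

theorem summable_pow_natAbs_sub {ρ : ℝ} (h0 : 0 ≤ ρ) (h1 : ρ < 1) (m : ℕ) :
    Summable fun k : ℕ => ρ ^ ((k : ℤ) - m).natAbs :=
  (summable_pow_natAbs h0 h1).comp_injective (injective_natCast_sub m)

theorem tsum_pow_natAbs_sub_le {ρ : ℝ} (h0 : 0 ≤ ρ) (h1 : ρ < 1) (m : ℕ) :
    ∑' k : ℕ, ρ ^ ((k : ℤ) - m).natAbs ≤ ∑' z : ℤ, ρ ^ z.natAbs :=
  tsum_comp_le_tsum_of_inj (summable_pow_natAbs h0 h1) (fun _ => by positivity)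
    (injective_natCast_sub m)

/-! ### The tilted weights -/

section Weights

variable {β γ : ℝ} {n : ℕ}

theorem degWeight_pos (β γ : ℝ) (n k : ℕ) : 0 < degWeight β γ n k := by
  unfold degWeight
  positivity

theorem degWeight_succ (β γ : ℝ) (n k : ℕ) :
    degWeight β γ n (k + 1) =
      exp (γ * log n - β * (2 * k + 1)) / (k + 1) * degWeight β γ n k := by
  unfold degWeight
  have h : -β * ((k + 1 : ℕ) : ℝ) ^ 2 + γ * log n * ((k + 1 : ℕ) : ℝ) =
      (γ * log n - β * (2 * k + 1)) + (-β * (k : ℝ) ^ 2 + γ * log n * k) := by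
    push_cast
    ring
  rw [h, exp_add, Nat.factorial_succ]
  push_cast
  field_simp

theorem degWeight_add_two_mul (β γ : ℝ) (n k : ℕ) :
    degWeight β γ n (k + 2) * degWeight β γ n k =
      exp (-2 * β) * ((k + 1) / (k + 2)) * degWeight β γ n (k + 1) ^ 2 := by
  have h : exp (γ * log n - β * (2 * (k + 1 : ℕ) + 1)) =
      exp (-2 * β) * exp (γ * log n - β * (2 * k + 1)) := by
    rw [← exp_add]
    congr 1
    push_cast
    ring
  rw [degWeight_succ β γ n (k + 1), degWeight_succ β γ n k, h]
  push_cast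
  field_simp
  ring

theorem degWeight_logConcave (β γ : ℝ) (n k : ℕ) :
    degWeight β γ n (k + 2) * degWeight β γ n k ≤
      exp (-2 * β) * degWeight β γ n (k + 1) ^ 2 := by
  rw [degWeight_add_two_mul]
  refine mul_le_mul_of_nonneg_right (mul_le_of_le_one_right (exp_pos _).le ?_) (sq_nonneg _)
  rw [div_le_one (by positivity)]
  linarith

/-- The weights have a mode `m`; when the tilt is nonnegative, the weight at `m + 1` is
comparable to the one at `m`. -/
theorem exists_mode (hβ : 0 < β) (hγ : 0 ≤ γ * log n) :
    ∃ m : ℕ, (∀ k < m, degWeight β γ n k ≤ degWeight β γ n (k + 1)) ∧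
      degWeight β γ n (m + 1) ≤ degWeight β γ n m ∧
      exp (-2 * β) / 2 * degWeight β γ n m ≤ degWeight β γ n (m + 1) := by
  classical
  have hex : ∃ k, degWeight β γ n (k + 1) ≤ degWeight β γ n k := by
    obtain ⟨k, hk⟩ := exists_nat_ge (γ * log n / β)
    refine ⟨k, ?_⟩
    rw [degWeight_succ]
    refine mul_le_of_le_one_left (degWeight_pos _ _ _ _).le ?_
    rw [div_le_one (by positivity)]
    rw [div_le_iff₀ hβ] at hk
    have h0 : (0 : ℝ) ≤ k := k.cast_nonneg
    have : exp (γ * log n - β * (2 * k + 1)) ≤ 1 := exp_le_one_iff.mpr (by nlinarith)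
    linarith
  have hlt : ∀ k < Nat.find hex, degWeight β γ n k ≤ degWeight β γ n (k + 1) :=
    fun k hk => (not_le.mp (Nat.find_min hex hk)).le
  refine ⟨Nat.find hex, hlt, Nat.find_spec hex, ?_⟩
  rcases hm : Nat.find hex with _ | k
  · rw [degWeight_succ]
    refine mul_le_mul_of_nonneg_right ?_ (degWeight_pos _ _ _ _).le
    have h : exp (-2 * β) ≤ exp (γ * log n - β) := exp_le_exp.mpr (by linarith)
    have h2 := exp_pos (-2 * β)
    simp only [Nat.cast_zero, mul_zero, zero_add, mul_one, div_one]
    linarith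
  · have h := hlt k (by omega)
    refine le_of_mul_le_mul_right ?_ (degWeight_pos β γ n k)
    have hw := degWeight_pos β γ n (k + 1)
    have hw' := degWeight_pos β γ n k
    have hk : (1 : ℝ) / 2 ≤ (k + 1) / (k + 2) := by
      rw [div_le_div_iff₀ (by norm_num) (by positivity)]
      linarith [(k.cast_nonneg : (0 : ℝ) ≤ k)]
    calc exp (-2 * β) / 2 * degWeight β γ n (k + 1) * degWeight β γ n k
        = exp (-2 * β) * (1 / 2) * (degWeight β γ n (k + 1) * degWeight β γ n k) := by ring
      _ ≤ exp (-2 * β) * ((k + 1) / (k + 2)) *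
          (degWeight β γ n (k + 1) * degWeight β γ n (k + 1)) := by gcongr
      _ = degWeight β γ n (k + 1 + 1) * degWeight β γ n k := by
        rw [show k + 1 + 1 = k + 2 from rfl, degWeight_add_two_mul, sq]

end Weights

/-! ### Uniform estimates for probability mass functions with geometric decay -/

/-- The total mass of the dominating two-sided geometric sequence. -/
noncomputable def twoSidedMass (β : ℝ) : ℝ := ∑' z : ℤ, exp (-β) ^ z.natAbs

theorem exp_neg_lt_one {β : ℝ} (hβ : 0 < β) : exp (-β) < 1 :=
  exp_lt_one_iff.mpr (by linarith)

theorem twoSidedMass_pos {β : ℝ} (hβ : 0 < β) : 0 < twoSidedMass β :=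
  (summable_pow_natAbs (exp_pos _).le (exp_neg_lt_one hβ)).tsum_pos
    (fun _ => by positivity) 0 (by positivity)

section Decay

variable {β : ℝ} {p : ℕ → ℝ} {m : ℕ}

theorem exp_neg_pow_natAbs (β : ℝ) (k m : ℕ) :
    exp (-β) ^ ((k : ℤ) - m).natAbs = exp (-(β * |(k : ℝ) - m|)) := by
  rw [← exp_nat_mul, Nat.cast_natAbs]
  push_cast
  congr 1
  ring

theorem exp_abs_sub_mul_le (hp : ∀ k, p k ≤ exp (2 * β) * exp (-(2 * β * |(k : ℝ) - m|)) * p m)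
    (k : ℕ) :
    exp (β * |(k : ℝ) - m|) * p k ≤ exp (2 * β) * p m * exp (-β) ^ ((k : ℤ) - m).natAbs := by
  refine (mul_le_mul_of_nonneg_left (hp k) (exp_pos _).le).trans_eq ?_
  rw [exp_neg_pow_natAbs, show -(β * |(k : ℝ) - m|) = β * |(k : ℝ) - m| +
    -(2 * β * |(k : ℝ) - m|) by ring, exp_add (β * |(k : ℝ) - m|)]
  ring

theorem summable_exp_abs_sub_mode (hβ : 0 < β) (h0 : ∀ k, 0 ≤ p k)
    (hp : ∀ k, p k ≤ exp (2 * β) * exp (-(2 * β * |(k : ℝ) - m|)) * p m) :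
    Summable fun k : ℕ => exp (β * |(k : ℝ) - m|) * p k :=
  .of_nonneg_of_le (fun k => mul_nonneg (exp_pos _).le (h0 k)) (exp_abs_sub_mul_le hp)
    ((summable_pow_natAbs_sub (exp_pos _).le (exp_neg_lt_one hβ) m).mul_left _)

theorem tsum_exp_abs_sub_mode_le (hβ : 0 < β) (h0 : ∀ k, 0 ≤ p k)
    (hp : ∀ k, p k ≤ exp (2 * β) * exp (-(2 * β * |(k : ℝ) - m|)) * p m) :
    ∑' k : ℕ, exp (β * |(k : ℝ) - m|) * p k ≤ exp (2 * β) * p m * twoSidedMass β := by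
  have hs := summable_pow_natAbs_sub (exp_pos _).le (exp_neg_lt_one hβ) m
  refine ((summable_exp_abs_sub_mode hβ h0 hp).tsum_le_tsum (exp_abs_sub_mul_le hp)
    (hs.mul_left _)).trans ?_
  rw [tsum_mul_left]
  exact mul_le_mul_of_nonneg_left (tsum_pow_natAbs_sub_le (exp_pos _).le (exp_neg_lt_one hβ) m)
    (mul_nonneg (exp_pos _).le (h0 m))

theorem le_apply_mode (hβ : 0 < β) (h0 : ∀ k, 0 ≤ p k) (h1 : HasSum p 1)
    (hp : ∀ k, p k ≤ exp (2 * β) * exp (-(2 * β * |(k : ℝ) - m|)) * p m) :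
    (exp (2 * β) * twoSidedMass β)⁻¹ ≤ p m := by
  rw [inv_le_iff_one_le_mul₀ (mul_pos (exp_pos _) (twoSidedMass_pos hβ)), ← h1.tsum_eq]
  refine (h1.summable.tsum_le_tsum (fun k => ?_) (summable_exp_abs_sub_mode hβ h0 hp)).trans
    ((tsum_exp_abs_sub_mode_le hβ h0 hp).trans_eq (by ring))
  exact le_mul_of_one_le_left (h0 k) (one_le_exp (by positivity))

theorem tsum_exp_abs_sub_mode_le' (hβ : 0 < β) (h0 : ∀ k, 0 ≤ p k) (h1 : HasSum p 1)
    (hp : ∀ k, p k ≤ exp (2 * β) * exp (-(2 * β * |(k : ℝ) - m|)) * p m) :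
    ∑' k : ℕ, exp (β * |(k : ℝ) - m|) * p k ≤ exp (2 * β) * twoSidedMass β := by
  have hpm : p m ≤ 1 := le_hasSum h1 m fun k _ => h0 k
  refine (tsum_exp_abs_sub_mode_le hβ h0 hp).trans ?_
  refine mul_le_mul_of_nonneg_right ?_ (twoSidedMass_pos hβ).le
  exact mul_le_of_le_one_right (exp_pos _).le hpm

/-- The mean lies within a bounded distance of the mode. -/
theorem abs_mean_sub_mode_le (hβ : 0 < β) (h0 : ∀ k, 0 ≤ p k) (h1 : HasSum p 1)
    (hp : ∀ k, p k ≤ exp (2 * β) * exp (-(2 * β * |(k : ℝ) - m|)) * p m) :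
    β * |(∑' k : ℕ, (k : ℝ) * p k) - m| ≤ exp (2 * β) * twoSidedMass β := by
  have hE := summable_exp_abs_sub_mode hβ h0 hp
  have hle : ∀ k : ℕ, ‖β * (((k : ℝ) - m) * p k)‖ ≤ exp (β * |(k : ℝ) - m|) * p k := by
    intro k
    rw [norm_mul, norm_mul, Real.norm_eq_abs, Real.norm_eq_abs, Real.norm_eq_abs,
      abs_of_pos hβ, abs_of_nonneg (h0 k), ← mul_assoc]
    exact mul_le_mul_of_nonneg_right (by linarith [add_one_le_exp (β * |(k : ℝ) - m|)]) (h0 k)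
  have hs : Summable fun k : ℕ => β * (((k : ℝ) - m) * p k) := .of_norm_bounded hE hle
  have hs' : Summable fun k : ℕ => ((k : ℝ) - m) * p k :=
    (summable_mul_left_iff hβ.ne').mp hs
  have hmean : (∑' k : ℕ, (k : ℝ) * p k) - m = ∑' k : ℕ, ((k : ℝ) - m) * p k := by
    have h := (hs'.hasSum.add (h1.mul_left (m : ℝ))).tsum_eq
    have hfun : (fun k : ℕ => ((k : ℝ) - m) * p k + m * p k) = fun k : ℕ => (k : ℝ) * p k := by
      funext k
      ring
    rw [hfun] at h
    rw [h]
    ring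
  have habs : β * |∑' k : ℕ, ((k : ℝ) - m) * p k| = ‖∑' k : ℕ, β * (((k : ℝ) - m) * p k)‖ := by
    rw [tsum_mul_left, norm_mul, Real.norm_eq_abs, Real.norm_eq_abs, abs_of_pos hβ]
  rw [hmean, habs]
  exact (tsum_of_norm_bounded hE.hasSum hle).trans (tsum_exp_abs_sub_mode_le' hβ h0 h1 hp)

variable {μ M : ℝ}

theorem exp_abs_sub_le_of_near (hβ : 0 < β) (h0 : ∀ k, 0 ≤ p k) (hμ : β * |μ - m| ≤ M) (k : ℕ) :
    exp (β * |(k : ℝ) - μ|) * p k ≤ exp M * (exp (β * |(k : ℝ) - m|) * p k) := by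
  rw [← mul_assoc, ← exp_add]
  refine mul_le_mul_of_nonneg_right (exp_le_exp.mpr ?_) (h0 k)
  have h := abs_sub_le (k : ℝ) m μ
  rw [abs_sub_comm (m : ℝ) μ] at h
  nlinarith

theorem summable_exp_abs_sub (hβ : 0 < β) (h0 : ∀ k, 0 ≤ p k)
    (hp : ∀ k, p k ≤ exp (2 * β) * exp (-(2 * β * |(k : ℝ) - m|)) * p m)
    (hμ : β * |μ - m| ≤ M) :
    Summable fun k : ℕ => exp (β * |(k : ℝ) - μ|) * p k :=
  .of_nonneg_of_le (fun k => mul_nonneg (exp_pos _).le (h0 k))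
    (exp_abs_sub_le_of_near hβ h0 hμ) ((summable_exp_abs_sub_mode hβ h0 hp).mul_left _)

theorem tsum_exp_abs_sub_le (hβ : 0 < β) (h0 : ∀ k, 0 ≤ p k) (h1 : HasSum p 1)
    (hp : ∀ k, p k ≤ exp (2 * β) * exp (-(2 * β * |(k : ℝ) - m|)) * p m)
    (hμ : β * |μ - m| ≤ M) :
    ∑' k : ℕ, exp (β * |(k : ℝ) - μ|) * p k ≤ exp M * (exp (2 * β) * twoSidedMass β) := by
  refine ((summable_exp_abs_sub hβ h0 hp hμ).tsum_le_tsum (exp_abs_sub_le_of_near hβ h0 hμ)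
    ((summable_exp_abs_sub_mode hβ h0 hp).mul_left _)).trans ?_
  rw [tsum_mul_left]
  exact mul_le_mul_of_nonneg_left (tsum_exp_abs_sub_mode_le' hβ h0 h1 hp) (exp_pos _).le

theorem summable_sq_sub (hβ : 0 < β) (h0 : ∀ k, 0 ≤ p k)
    (h : Summable fun k : ℕ => exp (β * |(k : ℝ) - μ|) * p k) :
    Summable fun k : ℕ => ((k : ℝ) - μ) ^ 2 * p k := by
  refine .of_nonneg_of_le (fun k => mul_nonneg (sq_nonneg _) (h0 k)) (fun k => ?_)
    (h.mul_left (2 / β ^ 2))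
  rw [← mul_assoc]
  refine mul_le_mul_of_nonneg_right ?_ (h0 k)
  have hx : 0 ≤ β * |(k : ℝ) - μ| := by positivity
  have hq := quadratic_le_exp_of_nonneg hx
  rw [div_mul_eq_mul_div, le_div_iff₀ (by positivity)]
  rw [mul_pow, sq_abs] at hq
  linarith

/-- The variance is bounded below by the mass on two consecutive points. -/
theorem min_div_two_le_variance (h0 : ∀ k, 0 ≤ p k)
    (h : Summable fun k : ℕ => ((k : ℝ) - μ) ^ 2 * p k) (m : ℕ) :
    min (p m) (p (m + 1)) / 2 ≤ ∑' k : ℕ, ((k : ℝ) - μ) ^ 2 * p k := by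
  have hs := h.sum_le_tsum {m, m + 1} fun k _ => mul_nonneg (sq_nonneg _) (h0 k)
  rw [Finset.sum_pair (by omega)] at hs
  refine le_trans ?_ hs
  push_cast
  set s := min (p m) (p (m + 1))
  have hs0 : 0 ≤ s := le_min (h0 _) (h0 _)
  calc s / 2 ≤ ((m : ℝ) - μ) ^ 2 * s + ((m : ℝ) + 1 - μ) ^ 2 * s := by
        nlinarith [mul_nonneg hs0 (sq_nonneg (2 * ((m : ℝ) - μ) + 1))]
    _ ≤ _ := add_le_add (mul_le_mul_of_nonneg_left (min_le_left _ _) (sq_nonneg _))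
        (mul_le_mul_of_nonneg_left (min_le_right _ _) (sq_nonneg _))

theorem min_le_tsum_min (h0 : ∀ k, 0 ≤ p k) (h : Summable p) (m : ℕ) :
    min (p m) (p (m + 1)) ≤ ∑' k : ℕ, min (p k) (p (k + 1)) := by
  have hmin : ∀ k, 0 ≤ min (p k) (p (k + 1)) := fun k => le_min (h0 _) (h0 _)
  exact (Summable.of_nonneg_of_le hmin (fun k => min_le_left _ _) h).le_tsum m fun k _ => hmin k

end Decay

/-! ### The tilted probability mass function -/

theorem degPMF_nonneg (β γ : ℝ) (n k : ℕ) : 0 ≤ degPMF β γ n k :=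
  div_nonneg (degWeight_pos _ _ _ _).le (tsum_nonneg fun j => (degWeight_pos _ _ _ j).le)

/-- For a nonnegative tilt the mass function of `D₁` sums to one, decays geometrically away from
a mode, and gives comparable mass to the successor of the mode. -/
theorem exists_degPMF_decay {β γ : ℝ} {n : ℕ} (hβ : 0 < β) (hγ : 0 ≤ γ * log n) :
    HasSum (degPMF β γ n) 1 ∧ ∃ m : ℕ,
      (∀ k, degPMF β γ n k ≤
        exp (2 * β) * exp (-(2 * β * |(k : ℝ) - m|)) * degPMF β γ n m) ∧
      exp (-2 * β) / 2 * degPMF β γ n m ≤ degPMF β γ n (m + 1) := by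
  obtain ⟨m, hlt, hle, hnext⟩ := exists_mode hβ hγ
  have hwp := degWeight_pos β γ n
  have hdec : ∀ k, degWeight β γ n k ≤
      exp (2 * β) * exp (-(2 * β * |(k : ℝ) - m|)) * degWeight β γ n m := by
    intro k
    have h := decay_of_mode hwp (exp_pos _) (exp_le_one_iff.mpr (by linarith))
      (degWeight_logConcave β γ n) hlt hle k
    rwa [neg_mul, exp_neg_pow_natAbs, ← exp_neg, neg_neg] at h
  have hE := summable_exp_abs_sub_mode hβ (fun k => (hwp k).le) hdec
  have hs : Summable (degWeight β γ n) :=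
    .of_nonneg_of_le (fun k => (hwp k).le)
      (fun k => le_mul_of_one_le_left (hwp k).le (one_le_exp (by positivity))) hE
  have hZ : 0 < ∑' j, degWeight β γ n j := hs.tsum_pos (fun k => (hwp k).le) 0 (hwp 0)
  refine ⟨?_, m, fun k => ?_, ?_⟩
  · have h := hs.hasSum.div_const (∑' j, degWeight β γ n j)
    rwa [div_self hZ.ne'] at h
  · unfold degPMF
    rw [← mul_div_assoc]
    exact div_le_div_of_nonneg_right (hdec k) hZ.le
  · unfold degPMF
    rw [← mul_div_assoc]
    exact div_le_div_of_nonneg_right hnext hZ.le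

/-- **Lemma.** The centred variables `X_{n1} = D₁ - E[D₁]` satisfy:
(i) `limsup_{n→∞} E[e^{θ|X_{n1}|}] < ∞` for some `θ > 0`;
(ii) `liminf_{n→∞} Var(X_{n1}) > 0`;
(iii) `liminf_{n→∞} Σ_j min{P(X_{n1}=j), P(X_{n1}=j+1)} > 0` (equivalently, the analogous
sum over the lattice of `D₁`). Here `D₁` has pmf `degPMF β (γ n) n`, the tilt `γ n` being
chosen so that `E[D₁] = c log n`. -/
theorem centred_conditions (β c : ℝ) (hβ : 0 < β) (hc : 0 < c)
    (γ : ℕ → ℝ) (hγ : ∀ n, 0 < γ n)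
    (hmean : ∀ n : ℕ, 2 ≤ n → degMean β (γ n) n = c * Real.log n) :
    (∃ θ > (0 : ℝ), ∃ C : ℝ, ∀ᶠ n : ℕ in Filter.atTop,
        (∑' k : ℕ, Real.exp (θ * |(k : ℝ) - degMean β (γ n) n|) * degPMF β (γ n) n k) ≤ C) ∧
    (∃ v > (0 : ℝ), ∀ᶠ n : ℕ in Filter.atTop, v ≤ degVar β (γ n) n) ∧
    (∃ s > (0 : ℝ), ∀ᶠ n : ℕ in Filter.atTop,
        s ≤ ∑' k : ℕ, min (degPMF β (γ n) n k) (degPMF β (γ n) n (k + 1))) := by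
  have hS := twoSidedMass_pos hβ
  have htilt : ∀ n : ℕ, 0 ≤ γ n * log n := fun n => mul_nonneg (hγ n).le (log_natCast_nonneg n)
  set M := exp (2 * β) * twoSidedMass β
  have hM0 : 0 < M := by positivity
  have hmin : ∀ n : ℕ, ∀ m : ℕ, M⁻¹ ≤ degPMF β (γ n) n m →
      exp (-2 * β) / 2 * degPMF β (γ n) n m ≤ degPMF β (γ n) n (m + 1) →
      exp (-2 * β) / 2 * M⁻¹ ≤ min (degPMF β (γ n) n m) (degPMF β (γ n) n (m + 1)) := by
    intro n m h1 h2
    have he : exp (-2 * β) ≤ 1 := exp_le_one_iff.mpr (by linarith)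
    have hi : 0 < M⁻¹ := inv_pos.mpr hM0
    refine le_min ((mul_le_of_le_one_left hi.le (by linarith)).trans h1) (le_trans ?_ h2)
    exact mul_le_mul_of_nonneg_left h1 (by positivity)
  refine ⟨⟨β, hβ, exp M * M, .of_forall fun n => ?_⟩,
    ⟨exp (-2 * β) / 2 * M⁻¹ / 2, by positivity, .of_forall fun n => ?_⟩,
    ⟨exp (-2 * β) / 2 * M⁻¹, by positivity, .of_forall fun n => ?_⟩⟩ <;>
  obtain ⟨h1, m, hdec, hnext⟩ := exists_degPMF_decay hβ (htilt n) <;>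
  have h0 := degPMF_nonneg β (γ n) n
  · exact tsum_exp_abs_sub_le hβ h0 h1 hdec (abs_mean_sub_mode_le hβ h0 h1 hdec)
  · have hsum := summable_exp_abs_sub hβ h0 hdec (abs_mean_sub_mode_le hβ h0 h1 hdec)
    have hvar := min_div_two_le_variance h0 (summable_sq_sub hβ h0 hsum) m
    exact (div_le_div_of_nonneg_right (hmin n m (le_apply_mode hβ h0 h1 hdec) hnext)
      zero_le_two).trans hvar
  · exact (hmin n m (le_apply_mode hβ h0 h1 hdec) hnext).trans
      (min_le_tsum_min h0 h1.summable m)
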